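/- arXiv:2112.15430 — 2 statements merged into one kernel-verified Lean document; each statement's English description precedes it below -/
import Mathlib

section
/- Monotonicity of the diatomic Bellman operator: let α ∈ (0,1) and π ∈ Π. If Q = (Q₁,Q₂) and Q̃ = (Q̃₁,Q̃₂) are functions X×A → ℝ² with Q ≥ Q̃, then T^π_α Q ≥ T^π_α Q̃. -/
open MeasureTheory ProbabilityTheory Finset Set

noncomputable section

/-- Quantile (generalized inverse distribution) function of a measure on `ℝ`. -/
def quantileFn (ν : Measure ℝ) (τ : ℝ) : ℝ :=
  sInf {z : ℝ | τ ≤ cdf ν z}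

/-- Left average value-at-risk at level `α`. -/
def avarLeft (α : ℝ) (ν : Measure ℝ) : ℝ :=
  (1 / α) * ∫ τ in (0:ℝ)..α, quantileFn ν τ

/-- Right average value-at-risk at level `1 - α`. -/
def avarRight (α : ℝ) (ν : Measure ℝ) : ℝ :=
  (1 / (1 - α)) * ∫ τ in α..(1:ℝ), quantileFn ν τ

/-- A measure on `ℝ` with bounded support. -/
def HasBoundedSupport (ν : Measure ℝ) : Prop :=
  ∃ a b : ℝ, ν (Set.Icc a b)ᶜ = 0

/-- Finite Markov decision process with fixed state and action spaces. -/
structure MDP (X A : Type) [Fintype X] [Fintype A] where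
  P : X → A → X → ℝ
  r : X → A → X → ℝ
  γ : ℝ
  P_nonneg : ∀ x a x', 0 ≤ P x a x'
  P_sum_one : ∀ x a, ∑ x', P x a x' = 1
  γ_nonneg : 0 ≤ γ
  γ_lt_one : γ < 1

variable {X A : Type} [Fintype X] [Fintype A]

/-- A stationary Markovian policy. -/
def IsPolicy (π : X → A → ℝ) : Prop :=
  (∀ x a, 0 ≤ π x a) ∧ ∀ x, ∑ a, π x a = 1

/-- The discrete measure `(T^π D_{α,Q})^{(x,a)}`. -/
def diatomicMeasure (M : MDP X A) (α : ℝ) (π : X → A → ℝ)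
    (Q : X → A → ℝ × ℝ) (x : X) (a : A) : Measure ℝ :=
  ∑ x' : X, ∑ a' : A, ENNReal.ofReal (M.P x a x' * π x' a') •
    (ENNReal.ofReal α • Measure.dirac (M.r x a x' + M.γ * (Q x' a').1)
      + ENNReal.ofReal (1 - α) • Measure.dirac (M.r x a x' + M.γ * (Q x' a').2))

/-- The diatomic Bellman operator `T^π_α`. -/
def diatomicT (M : MDP X A) (α : ℝ) (π : X → A → ℝ)
    (Q : X → A → ℝ × ℝ) : X → A → ℝ × ℝ :=
  fun x a => (avarLeft α (diatomicMeasure M α π Q x a),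
              avarRight α (diatomicMeasure M α π Q x a))

theorem HasBoundedSupport.quantile_bounds {ν : Measure ℝ} [IsProbabilityMeasure ν]
    (hν : HasBoundedSupport ν) :
    ∃ a b : ℝ, ∀ τ ∈ Set.Ioc (0:ℝ) 1,
      b ∈ {z : ℝ | τ ≤ cdf ν z} ∧ a ∈ lowerBounds {z : ℝ | τ ≤ cdf ν z} := by
  obtain ⟨a, b, hab⟩ := hν
  refine ⟨a, b, fun τ hτ => ⟨?_, fun z hz => ?_⟩⟩
  · have hb : cdf ν b = 1 := by
      have hIic : ν (Set.Iic b)ᶜ = 0 :=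
        measure_mono_null (Set.compl_subset_compl.2 Set.Icc_subset_Iic_self) hab
      rw [cdf_eq_real, measureReal_def, (prob_compl_eq_zero_iff measurableSet_Iic).1 hIic,
        ENNReal.toReal_one]
    exact hτ.2.trans hb.ge
  · by_contra! hza
    have hcdf : cdf ν z = 0 := by
      have hIic : ν (Set.Iic z) = 0 :=
        measure_mono_null
          (fun y (hy : y ≤ z) (h : y ∈ Set.Icc a b) => (hza.trans_le h.1).not_ge hy) hab
      rw [cdf_eq_real, measureReal_def, hIic, ENNReal.toReal_zero]
    exact (hτ.1.trans_le hz).ne' hcdf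

theorem HasBoundedSupport.monotoneOn_quantileFn {ν : Measure ℝ} [IsProbabilityMeasure ν]
    (hν : HasBoundedSupport ν) : MonotoneOn (quantileFn ν) (Set.Ioc 0 1) := by
  obtain ⟨a, b, hab⟩ := hν.quantile_bounds
  exact fun σ hσ τ hτ hστ =>
    csInf_le_csInf ⟨a, (hab σ hσ).2⟩ ⟨b, (hab τ hτ).1⟩ fun _ hz => hστ.trans hz

theorem HasBoundedSupport.integrableOn_quantileFn {ν : Measure ℝ} [IsProbabilityMeasure ν]
    (hν : HasBoundedSupport ν) : IntegrableOn (quantileFn ν) (Set.Ioc 0 1) := by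
  obtain ⟨a, b, hab⟩ := hν.quantile_bounds
  refine Integrable.of_bound (aemeasurable_restrict_of_monotoneOn measurableSet_Ioc
    hν.monotoneOn_quantileFn).aestronglyMeasurable (max |a| |b|) ?_
  filter_upwards [ae_restrict_mem measurableSet_Ioc] with τ hτ
  obtain ⟨hb, ha⟩ := hab τ hτ
  exact abs_le_max_abs_abs (le_csInf ⟨b, hb⟩ ha) (csInf_le ⟨a, ha⟩ hb)

/-- First-order stochastic dominance gives domination of quantile functions. -/
theorem quantileFn_le_of_cdf_le {μ ν : Measure ℝ} [IsProbabilityMeasure μ]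
    [IsProbabilityMeasure ν] (hμ : HasBoundedSupport μ) (hν : HasBoundedSupport ν)
    (h : ∀ z, cdf ν z ≤ cdf μ z) {τ : ℝ} (hτ : τ ∈ Set.Ioc (0:ℝ) 1) :
    quantileFn μ τ ≤ quantileFn ν τ := by
  obtain ⟨a, _, ha⟩ := hμ.quantile_bounds
  obtain ⟨_, b, hb⟩ := hν.quantile_bounds
  exact csInf_le_csInf ⟨a, (ha τ hτ).2⟩ ⟨b, (hb τ hτ).1⟩ fun z hz => le_trans hz (h z)

theorem integral_quantileFn_le_of_cdf_le {μ ν : Measure ℝ} [IsProbabilityMeasure μ]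
    [IsProbabilityMeasure ν] (hμ : HasBoundedSupport μ) (hν : HasBoundedSupport ν)
    (h : ∀ z, cdf ν z ≤ cdf μ z) {s t : ℝ} (hs : 0 ≤ s) (hst : s ≤ t) (ht : t ≤ 1) :
    ∫ τ in s..t, quantileFn μ τ ≤ ∫ τ in s..t, quantileFn ν τ := by
  have hsub : Set.Ioc s t ⊆ Set.Ioc 0 1 := Set.Ioc_subset_Ioc hs ht
  rw [intervalIntegral.integral_of_le hst, intervalIntegral.integral_of_le hst]
  exact setIntegral_mono_on (hμ.integrableOn_quantileFn.mono_set hsub)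
    (hν.integrableOn_quantileFn.mono_set hsub) measurableSet_Ioc
    fun τ hτ => quantileFn_le_of_cdf_le hμ hν h (hsub hτ)

theorem avarLeft_le_of_cdf_le {μ ν : Measure ℝ} [IsProbabilityMeasure μ]
    [IsProbabilityMeasure ν] (hμ : HasBoundedSupport μ) (hν : HasBoundedSupport ν)
    (h : ∀ z, cdf ν z ≤ cdf μ z) {α : ℝ} (hα : α ∈ Set.Ioo (0:ℝ) 1) :
    avarLeft α μ ≤ avarLeft α ν :=
  mul_le_mul_of_nonneg_left
    (integral_quantileFn_le_of_cdf_le hμ hν h le_rfl hα.1.le hα.2.le)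
    (one_div_nonneg.2 hα.1.le)

theorem avarRight_le_of_cdf_le {μ ν : Measure ℝ} [IsProbabilityMeasure μ]
    [IsProbabilityMeasure ν] (hμ : HasBoundedSupport μ) (hν : HasBoundedSupport ν)
    (h : ∀ z, cdf ν z ≤ cdf μ z) {α : ℝ} (hα : α ∈ Set.Ioo (0:ℝ) 1) :
    avarRight α μ ≤ avarRight α ν :=
  mul_le_mul_of_nonneg_left
    (integral_quantileFn_le_of_cdf_le hμ hν h hα.1.le hα.2.le le_rfl)
    (one_div_nonneg.2 (sub_nonneg.2 hα.2.le))

theorem diatomicMeasure_apply (M : MDP X A) (α : ℝ) (π : X → A → ℝ)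
    (Q : X → A → ℝ × ℝ) (x : X) (a : A) (s : Set ℝ) :
    diatomicMeasure M α π Q x a s =
      ∑ x' : X, ∑ a' : A, ENNReal.ofReal (M.P x a x' * π x' a') *
        (ENNReal.ofReal α * Measure.dirac (M.r x a x' + M.γ * (Q x' a').1) s
          + ENNReal.ofReal (1 - α) * Measure.dirac (M.r x a x' + M.γ * (Q x' a').2) s) := by
  simp only [diatomicMeasure, Measure.finsetSum_apply, Measure.smul_apply, Measure.add_apply,
    smul_eq_mul]

theorem isProbabilityMeasure_diatomicMeasure (M : MDP X A) {α : ℝ}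
    (hα : α ∈ Set.Ioo (0:ℝ) 1) {π : X → A → ℝ} (hπ : IsPolicy π)
    (Q : X → A → ℝ × ℝ) (x : X) (a : A) :
    IsProbabilityMeasure (diatomicMeasure M α π Q x a) := by
  have hw : ENNReal.ofReal α + ENNReal.ofReal (1 - α) = 1 := by
    rw [← ENNReal.ofReal_add hα.1.le (sub_nonneg.2 hα.2.le), add_sub_cancel, ENNReal.ofReal_one]
  have hnonneg : ∀ x' a', 0 ≤ M.P x a x' * π x' a' := fun x' a' =>
    mul_nonneg (M.P_nonneg x a x') (hπ.1 x' a')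
  constructor
  simp only [diatomicMeasure_apply, measure_univ, mul_one, hw]
  simp_rw [← ENNReal.ofReal_sum_of_nonneg fun a' _ => hnonneg _ a']
  rw [← ENNReal.ofReal_sum_of_nonneg fun x' _ => Finset.sum_nonneg fun a' _ => hnonneg x' a']
  simp [← Finset.mul_sum, hπ.2, M.P_sum_one]

theorem hasBoundedSupport_diatomicMeasure (M : MDP X A) (α : ℝ) (π : X → A → ℝ)
    (Q : X → A → ℝ × ℝ) (x : X) (a : A) :
    HasBoundedSupport (diatomicMeasure M α π Q x a) := by
  let f : X × A → ℝ := fun p => M.r x a p.1 + M.γ * (Q p.1 p.2).1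
  let g : X × A → ℝ := fun p => M.r x a p.1 + M.γ * (Q p.1 p.2).2
  obtain ⟨l, u, hlu⟩ := bddBelow_bddAbove_iff_subset_Icc.1
    ⟨((Set.finite_range f).union (Set.finite_range g)).bddBelow,
      ((Set.finite_range f).union (Set.finite_range g)).bddAbove⟩
  refine ⟨l, u, ?_⟩
  have hf : ∀ x' a', M.r x a x' + M.γ * (Q x' a').1 ∈ Set.Icc l u := fun x' a' =>
    hlu (Or.inl ⟨(x', a'), rfl⟩)
  have hg : ∀ x' a', M.r x a x' + M.γ * (Q x' a').2 ∈ Set.Icc l u := fun x' a' =>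
    hlu (Or.inr ⟨(x', a'), rfl⟩)
  rw [diatomicMeasure_apply]
  refine Finset.sum_eq_zero fun x' _ => Finset.sum_eq_zero fun a' _ => ?_
  rw [Measure.dirac_apply' _ measurableSet_Icc.compl, Measure.dirac_apply' _ measurableSet_Icc.compl,
    Set.indicator_of_notMem (not_not_intro (hf x' a')),
    Set.indicator_of_notMem (not_not_intro (hg x' a'))]
  simp

theorem dirac_Iic_anti {u v : ℝ} (huv : u ≤ v) (z : ℝ) :
    Measure.dirac v (Set.Iic z) ≤ Measure.dirac u (Set.Iic z) := by
  rw [Measure.dirac_apply' _ measurableSet_Iic, Measure.dirac_apply' _ measurableSet_Iic]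
  by_cases hv : v ≤ z
  · simp [hv, huv.trans hv]
  · simp [hv]

theorem cdf_diatomicMeasure_anti (M : MDP X A) {α : ℝ}
    (hα : α ∈ Set.Ioo (0:ℝ) 1) {π : X → A → ℝ} (hπ : IsPolicy π)
    {Q Qt : X → A → ℝ × ℝ}
    (hle : ∀ x a, (Qt x a).1 ≤ (Q x a).1 ∧ (Qt x a).2 ≤ (Q x a).2) (x : X) (a : A) (z : ℝ) :
    cdf (diatomicMeasure M α π Q x a) z ≤ cdf (diatomicMeasure M α π Qt x a) z := by
  have := isProbabilityMeasure_diatomicMeasure M hα hπ Q x a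
  have := isProbabilityMeasure_diatomicMeasure M hα hπ Qt x a
  rw [cdf_eq_real, cdf_eq_real]
  refine ENNReal.toReal_mono (measure_ne_top _ _) ?_
  rw [diatomicMeasure_apply, diatomicMeasure_apply]
  have hstep : ∀ {c : ℝ} {q q' : ℝ}, q ≤ q' → c + M.γ * q ≤ c + M.γ * q' := fun h =>
    add_le_add_right (mul_le_mul_of_nonneg_left h M.γ_nonneg) _
  refine Finset.sum_le_sum fun x' _ => Finset.sum_le_sum fun a' _ => mul_le_mul_right ?_ _
  exact add_le_add (mul_le_mul_right (dirac_Iic_anti (hstep (hle x' a').1) z) _)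
    (mul_le_mul_right (dirac_Iic_anti (hstep (hle x' a').2) z) _)

theorem stmt3 (M : MDP X A) (α : ℝ) (hα : α ∈ Set.Ioo (0:ℝ) 1)
    (π : X → A → ℝ) (hπ : IsPolicy π)
    (Q Qt : X → A → ℝ × ℝ)
    (hle : ∀ x a, (Qt x a).1 ≤ (Q x a).1 ∧ (Qt x a).2 ≤ (Q x a).2) :
    ∀ x a, (diatomicT M α π Qt x a).1 ≤ (diatomicT M α π Q x a).1 ∧
      (diatomicT M α π Qt x a).2 ≤ (diatomicT M α π Q x a).2 := by
  intro x a
  have := isProbabilityMeasure_diatomicMeasure M hα hπ Q x a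
  have := isProbabilityMeasure_diatomicMeasure M hα hπ Qt x a
  have hQ := hasBoundedSupport_diatomicMeasure M α π Q x a
  have hQt := hasBoundedSupport_diatomicMeasure M α π Qt x a
  have hcdf := cdf_diatomicMeasure_anti M hα hπ hle x a
  exact ⟨avarLeft_le_of_cdf_le hQt hQ hcdf hα, avarRight_le_of_cdf_le hQt hQ hcdf hα⟩


end
end

section
/- Robust MDP interpretation: let α ∈ (0,1) and let π be an α-coherent policy with common fixed-point values (V₁^π(x), V₂^π(x)) at each state x. Then for every x ∈ X, V₁^π(x) = inf_{𝐏 ∈ Υ_α} V^π_𝐏(x̲) and V₂^π(x) = sup_{𝐏 ∈ Υ_α} V^π_𝐏(x̄); moreover there exists a single kernel 𝐏* ∈ Υ_α attaining simultaneously the infimum for every x and the supremum for every x. -/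
open MeasureTheory ProbabilityTheory Finset Set

noncomputable section

variable {X A : Type} [Fintype X] [Fintype A]

/-- Membership in the dichotomous uncertainty set `Υ_α`: `K` is a transition
kernel on the augmented state space `X × Bool` (`(x, false)` is the worst-case
substate `x̲`, `(x, true)` the best-case substate `x̄`) consistent with `P`. -/
def InUncertaintySet (M : MDP X A) (α : ℝ)
    (K : (X × Bool) → A → (X × Bool) → ℝ) : Prop :=
  (∀ s a s', 0 ≤ K s a s') ∧ (∀ s a, ∑ s', K s a s' = 1) ∧
  ∀ x a x',
    α * K (x, false) a (x', false) + (1 - α) * K (x, true) a (x', false) =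
        α * M.P x a x' ∧
    α * K (x, false) a (x', true) + (1 - α) * K (x, true) a (x', true) =
        (1 - α) * M.P x a x' ∧
    (α / (1 - α)) * K (x, false) a (x', true) ≤ K (x, false) a (x', false)

/-- `V` is the value function of the (extended) policy `π` in the augmented MDP
with transition kernel `K`, reward `r(s,a,s') = r(x,a,x')` and discount `γ`. -/
def IsAugValue (M : MDP X A) (π : X → A → ℝ)
    (K : (X × Bool) → A → (X × Bool) → ℝ) (V : X × Bool → ℝ) : Prop :=
  ∀ s : X × Bool, V s =
    ∑ a, π s.1 a * ∑ s' : X × Bool, K s a s' * (M.r s.1 a s'.1 + M.γ * V s')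

/-- The Galois connection between the quantile function and the distribution function. -/
theorem quantileFn_le_iff (ν : Measure ℝ) {τ : ℝ} (h0 : 0 < τ) (h1 : τ < 1) (z : ℝ) :
    quantileFn ν τ ≤ z ↔ τ ≤ cdf ν z := by
  have hne : {z : ℝ | τ ≤ cdf ν z}.Nonempty :=
    (((tendsto_cdf_atTop ν).eventually (lt_mem_nhds h1)).exists).imp fun _ h => le_of_lt h
  have hbdd : BddBelow {z : ℝ | τ ≤ cdf ν z} := by
    obtain ⟨b, hb⟩ := ((tendsto_cdf_atBot ν).eventually (gt_mem_nhds h0)).exists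
    refine ⟨b, fun z hz => ?_⟩
    by_contra! hlt
    exact absurd (hz.trans (monotone_cdf ν hlt.le)) (not_le.mpr hb)
  constructor
  · intro h
    have hright : ContinuousWithinAt (cdf ν) (Set.Ioi z) z :=
      ((cdf ν).right_continuous z).mono Set.Ioi_subset_Ici_self
    refine ge_of_tendsto hright ?_
    filter_upwards [self_mem_nhdsWithin] with y hy
    obtain ⟨u, hu, huy⟩ := (csInf_lt_iff hbdd hne).1 (lt_of_le_of_lt h hy)
    exact le_trans hu (monotone_cdf ν huy.le)
  · exact fun h => csInf_le hbdd h

theorem monotoneOn_quantileFn (ν : Measure ℝ) : MonotoneOn (quantileFn ν) (Set.Ioo 0 1) := by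
  intro σ hσ τ hτ hle
  rw [quantileFn_le_iff ν hσ.1 hσ.2]
  exact hle.trans ((quantileFn_le_iff ν hτ.1 hτ.2 _).1 le_rfl)

theorem aemeasurable_quantileFn (ν : Measure ℝ) :
    AEMeasurable (quantileFn ν) (volume.restrict (Set.Ioo (0 : ℝ) 1)) :=
  aemeasurable_restrict_of_monotoneOn measurableSet_Ioo (monotoneOn_quantileFn ν)

/-- The quantile function pushes the uniform distribution forward to the given measure. -/
theorem map_quantileFn (ν : Measure ℝ) [IsProbabilityMeasure ν] :
    (volume.restrict (Set.Ioo (0 : ℝ) 1)).map (quantileFn ν) = ν := by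
  have hm := aemeasurable_quantileFn ν
  have : IsFiniteMeasure ((volume.restrict (Set.Ioo (0 : ℝ) 1)).map (quantileFn ν)) :=
    Measure.isFiniteMeasure_map _ _
  refine Measure.ext_of_Iic _ _ fun z => ?_
  rw [Measure.map_apply_of_aemeasurable hm measurableSet_Iic,
    Measure.restrict_apply' measurableSet_Ioo, ← ofReal_cdf ν z]
  have hset : (quantileFn ν ⁻¹' Set.Iic z ∩ Set.Ioo 0 1 : Set ℝ) =ᵐ[volume]
      Set.Ioc 0 (cdf ν z) := by
    have heq : quantileFn ν ⁻¹' Set.Iic z ∩ Set.Ioo 0 1 =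
        Set.Ioc 0 (cdf ν z) ∩ Set.Iio 1 := by
      ext τ
      simp only [Set.mem_inter_iff, Set.mem_preimage, Set.mem_Iic, Set.mem_Ioo, Set.mem_Ioc,
        Set.mem_Iio]
      constructor
      · rintro ⟨h, h0, h1⟩
        exact ⟨⟨h0, (quantileFn_le_iff ν h0 h1 z).1 h⟩, h1⟩
      · rintro ⟨⟨h0, h⟩, h1⟩
        exact ⟨(quantileFn_le_iff ν h0 h1 z).2 h, h0, h1⟩
    rw [heq]
    have hae : ∀ᵐ τ : ℝ, τ ≠ 1 := by simp [ae_iff]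
    filter_upwards [hae] with τ hτ
    refine propext ⟨fun h => h.1, fun h => ⟨h, ?_⟩⟩
    exact lt_of_le_of_ne (h.2.trans (cdf_le_one ν z)) hτ
  rw [measure_congr hset, Real.volume_Ioc, sub_zero]

theorem integrable_sum_ofReal_smul_dirac {ι : Type*} [Fintype ι] (w v : ι → ℝ) (f : ℝ → ℝ) :
    Integrable f (∑ i, ENNReal.ofReal (w i) • Measure.dirac (v i)) :=
  integrable_finsetSum_measure.2 fun _ _ =>
    (integrable_dirac (by simp)).smul_measure ENNReal.ofReal_ne_top

theorem integral_sum_ofReal_smul_dirac {ι : Type*} [Fintype ι] {w : ι → ℝ} (hw : ∀ i, 0 ≤ w i)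
    (v : ι → ℝ) (f : ℝ → ℝ) :
    ∫ z, f z ∂(∑ i, ENNReal.ofReal (w i) • Measure.dirac (v i)) = ∑ i, w i * f (v i) := by
  rw [integral_finsetSum_measure fun i _ =>
    (integrable_dirac (by simp)).smul_measure ENNReal.ofReal_ne_top]
  simp [integral_smul_measure, hw]

/-- The fraction of an atom at `v` that lies in a lower tail which ends at `t` and contains a
fraction `θ` of the mass at `t`. -/
def tailFraction (t θ v : ℝ) : ℝ :=
  if v < t then 1 else if v = t then θ else 0

theorem tailFraction_mem_Icc {θ : ℝ} (hθ : θ ∈ Set.Icc (0 : ℝ) 1) (t v : ℝ) :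
    tailFraction t θ v ∈ Set.Icc (0 : ℝ) 1 := by
  unfold tailFraction
  split_ifs
  · simp
  · exact hθ
  · simp

theorem tailFraction_antitone {θ : ℝ} (hθ : θ ∈ Set.Icc (0 : ℝ) 1) (t : ℝ) :
    Antitone (tailFraction t θ) := by
  intro u v huv
  unfold tailFraction
  split_ifs <;> first | linarith [hθ.1, hθ.2] | (exfalso; grind)

theorem exists_tailFraction {ι : Type*} [Fintype ι] {w : ι → ℝ} (hw : ∀ i, 0 ≤ w i)
    (hw1 : ∑ i, w i = 1) (v : ι → ℝ) {α : ℝ} (hα : α ∈ Set.Ioo (0 : ℝ) 1) :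
    ∃ t θ : ℝ, θ ∈ Set.Icc (0 : ℝ) 1 ∧ ∑ i, w i * tailFraction t θ (v i) = α ∧
      α * avarLeft α (∑ i, ENNReal.ofReal (w i) • Measure.dirac (v i)) =
        ∑ i, w i * tailFraction t θ (v i) * v i ∧
      (1 - α) * avarRight α (∑ i, ENNReal.ofReal (w i) • Measure.dirac (v i)) =
        ∑ i, w i * (1 - tailFraction t θ (v i)) * v i := by
  obtain ⟨hα0, hα1⟩ := hα
  set ν : Measure ℝ := ∑ i, ENNReal.ofReal (w i) • Measure.dirac (v i) with hν
  have hprob : IsProbabilityMeasure ν := by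
    constructor
    simp [hν, ← ENNReal.ofReal_sum_of_nonneg fun i _ => hw i, hw1]
  have hm := aemeasurable_quantileFn ν
  have hmap := map_quantileFn ν
  have hint (f : ℝ → ℝ) : IntegrableOn (fun τ => f (quantileFn ν τ)) (Set.Ioo 0 1) := by
    have h := integrable_sum_ofReal_smul_dirac w v f
    rw [← hν, ← hmap] at h
    exact (integrable_map_measure h.aestronglyMeasurable hm).1 h
  have hval (f : ℝ → ℝ) : ∫ τ in Set.Ioo 0 1, f (quantileFn ν τ) = ∑ i, w i * f (v i) := by
    have h := integrable_sum_ofReal_smul_dirac w v f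
    rw [← hν, ← hmap] at h
    rw [← integral_sum_ofReal_smul_dirac hw v f, ← hν, ← integral_map hm h.aestronglyMeasurable,
      hmap]
  set t := quantileFn ν α with ht
  have hq_le {τ : ℝ} (hτ : τ ∈ Set.Ioo (0 : ℝ) 1) (h : τ ≤ α) : quantileFn ν τ ≤ t :=
    monotoneOn_quantileFn ν hτ ⟨hα0, hα1⟩ h
  have hq_ge {τ : ℝ} (hτ : τ ∈ Set.Ioo (0 : ℝ) 1) (h : α ≤ τ) : t ≤ quantileFn ν τ :=
    monotoneOn_quantileFn ν ⟨hα0, hα1⟩ hτ h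
  have hsub0 : Set.Ioo 0 α ⊆ Set.Ioo (0 : ℝ) 1 := Set.Ioo_subset_Ioo_right hα1.le
  have hvol : ∫ _ in Set.Ioo 0 α, (1 : ℝ) = α := by simp [hα0.le]
  have hind (f : ℝ → ℝ) : ∫ τ in Set.Ioo 0 1, (Set.Ioo 0 α).indicator f τ =
      ∫ τ in Set.Ioo 0 α, f τ := by
    rw [integral_indicator measurableSet_Ioo, Measure.restrict_restrict measurableSet_Ioo,
      Set.inter_eq_left.2 hsub0]
  have hindint {f : ℝ → ℝ} (hf : IntegrableOn f (Set.Ioo 0 1)) :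
      IntegrableOn ((Set.Ioo 0 α).indicator f) (Set.Ioo 0 1) :=
    hf.indicator measurableSet_Ioo
  have hone : IntegrableOn (fun _ : ℝ => (1 : ℝ)) (Set.Ioo 0 1) := by simp
  have hlt : ∑ i, w i * (if v i < t then 1 else 0) ≤ α := by
    rw [← hval fun z => if z < t then 1 else 0, ← hvol, ← hind]
    refine setIntegral_mono_on (hint fun z => if z < t then 1 else 0) (hindint hone) measurableSet_Ioo fun τ hτ => ?_
    by_cases h : τ < α
    · rw [Set.indicator_of_mem (show τ ∈ Set.Ioo 0 α from ⟨hτ.1, h⟩)]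
      split_ifs <;> norm_num
    · rw [if_neg (not_lt.2 (hq_ge hτ (not_lt.1 h)))]
      exact Set.indicator_nonneg (fun _ _ => zero_le_one) _
  have hle : α ≤ ∑ i, w i * (if v i ≤ t then 1 else 0) := by
    rw [← hval fun z => if z ≤ t then 1 else 0]
    refine le_of_eq_of_le (hvol.symm.trans (hind _).symm) ?_
    refine setIntegral_mono_on (hindint hone) (hint fun z => if z ≤ t then 1 else 0)
      measurableSet_Ioo fun τ hτ => ?_
    by_cases h : τ < α
    · rw [Set.indicator_of_mem (show τ ∈ Set.Ioo 0 α from ⟨hτ.1, h⟩), if_pos (hq_le hτ h.le)]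
    · rw [Set.indicator_of_notMem fun h' => h h'.2]
      split_ifs <;> norm_num
  have hsum : ∑ i, w i * (if v i ≤ t then 1 else 0) =
      ∑ i, w i * (if v i < t then 1 else 0) + ∑ i, w i * (if v i = t then 1 else 0) := by
    rw [← Finset.sum_add_distrib]
    refine Finset.sum_congr rfl fun i _ => ?_
    rcases lt_trichotomy (v i) t with h | h | h
    · simp [h, h.le, h.ne]
    · simp [h]
    · simp [h.not_ge, h.not_gt, h.ne']
  have hfrac (θ : ℝ) : ∑ i, w i * tailFraction t θ (v i) =
      ∑ i, w i * (if v i < t then 1 else 0) + θ * ∑ i, w i * (if v i = t then 1 else 0) := by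
    rw [Finset.mul_sum, ← Finset.sum_add_distrib]
    refine Finset.sum_congr rfl fun i _ => ?_
    unfold tailFraction
    rcases lt_trichotomy (v i) t with h | h | h
    · simp [h, h.ne]
    · simp [h, mul_comm]
    · simp [h.not_gt, h.ne']
  obtain ⟨θ, hθ, hθα⟩ : ∃ θ ∈ Set.Icc (0 : ℝ) 1, ∑ i, w i * tailFraction t θ (v i) = α := by
    simp only [hfrac]
    generalize ∑ i, w i * (if v i < t then (1 : ℝ) else 0) = a at *
    generalize ∑ i, w i * (if v i = t then (1 : ℝ) else 0) = b at *
    rw [hsum] at hle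
    rcases (show 0 ≤ b by linarith).eq_or_lt with hb | hb
    · exact ⟨0, by simp, by linarith⟩
    · refine ⟨(α - a) / b, ⟨div_nonneg (by linarith) hb.le, (div_le_one hb).2 (by linarith)⟩, ?_⟩
      rw [div_mul_cancel₀ _ hb.ne']
      ring
  have hintq := hint fun z => z
  have hleft : ∫ τ in Set.Ioo 0 α, quantileFn ν τ = ∑ i, w i * tailFraction t θ (v i) * v i := by
    have hpos : ∫ τ in Set.Ioo 0 α, (t - quantileFn ν τ) = ∑ i, w i * max (t - v i) 0 := by
      rw [← hval fun z => max (t - z) 0, ← hind]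
      refine setIntegral_congr_fun measurableSet_Ioo fun τ hτ => ?_
      by_cases h : τ < α
      · simp only [Set.indicator_of_mem (show τ ∈ Set.Ioo 0 α from ⟨hτ.1, h⟩)]
        exact (max_eq_left (sub_nonneg.2 (hq_le hτ h.le))).symm
      · simp only [Set.indicator_of_notMem fun h' : τ ∈ Set.Ioo 0 α => h h'.2]
        exact (max_eq_right (sub_nonpos.2 (hq_ge hτ (not_lt.1 h)))).symm
    have hconst : ∫ _ in Set.Ioo 0 α, t = α * t := by simp [hα0.le]
    rw [integral_sub (by simp) (hintq.mono_set hsub0), hconst] at hpos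
    have hterm : ∑ i, w i * tailFraction t θ (v i) * v i =
        (∑ i, w i * tailFraction t θ (v i)) * t - ∑ i, w i * max (t - v i) 0 := by
      rw [Finset.sum_mul, ← Finset.sum_sub_distrib]
      refine Finset.sum_congr rfl fun i _ => ?_
      unfold tailFraction
      rcases lt_trichotomy (v i) t with h | h | h
      · simp only [h, if_true, max_eq_left (sub_pos.2 h).le]
        ring
      · simp [h]
      · simp [h.not_gt, h.ne', h.le]
    rw [hterm, hθα]
    linarith
  have hII : IntervalIntegrable (quantileFn ν) volume 0 1 := by
    rw [intervalIntegrable_iff_integrableOn_Ioo_of_le zero_le_one]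
    exact hintq
  have hL : ∫ τ in (0 : ℝ)..α, quantileFn ν τ = ∑ i, w i * tailFraction t θ (v i) * v i := by
    rw [intervalIntegral.integral_of_le hα0.le, integral_Ioc_eq_integral_Ioo, hleft]
  have hT : ∫ τ in (0 : ℝ)..1, quantileFn ν τ = ∑ i, w i * v i := by
    rw [intervalIntegral.integral_of_le zero_le_one, integral_Ioc_eq_integral_Ioo]
    exact hval fun z => z
  have hα' : α ∈ Set.uIcc (0 : ℝ) 1 := Set.mem_uIcc_of_le hα0.le hα1.le
  have hadd := intervalIntegral.integral_add_adjacent_intervals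
    (hII.mono_set (Set.uIcc_subset_uIcc_left hα')) (hII.mono_set (Set.uIcc_subset_uIcc_right hα'))
  refine ⟨t, θ, hθ, hθα, ?_, ?_⟩
  · rw [avarLeft, hL, one_div, mul_inv_cancel_left₀ hα0.ne']
  · rw [avarRight, one_div, mul_inv_cancel_left₀ (sub_pos.2 hα1).ne']
    simp only [mul_sub, sub_mul, mul_one, Finset.sum_sub_distrib]
    linarith

/-- The lower `α`-tail of a finitely supported distribution: a fraction `φ i` of each atom such
that both average values-at-risk are means over the corresponding parts, and the lower part has
the least mean among all parts of mass `α`. -/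
theorem exists_lowerTail {ι : Type*} [Fintype ι] {w : ι → ℝ} (hw : ∀ i, 0 ≤ w i)
    (hw1 : ∑ i, w i = 1) (v : ι → ℝ) {α : ℝ} (hα : α ∈ Set.Ioo (0 : ℝ) 1) :
    ∃ φ : ι → ℝ, (∀ i, φ i ∈ Set.Icc (0 : ℝ) 1) ∧ ∑ i, w i * φ i = α ∧
      α * avarLeft α (∑ i, ENNReal.ofReal (w i) • Measure.dirac (v i)) =
        ∑ i, w i * φ i * v i ∧
      (1 - α) * avarRight α (∑ i, ENNReal.ofReal (w i) • Measure.dirac (v i)) =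
        ∑ i, w i * (1 - φ i) * v i ∧
      (∀ i j, v i ≤ v j → φ j ≤ φ i) ∧
      ∀ κ : ι → ℝ, (∀ i, 0 ≤ κ i) → (∀ i, κ i ≤ w i) → ∑ i, κ i = α →
        ∑ i, w i * φ i * v i ≤ ∑ i, κ i * v i := by
  obtain ⟨t, θ, hθ, hθα, hL, hR⟩ := exists_tailFraction hw hw1 v hα
  refine ⟨fun i => tailFraction t θ (v i), fun i => tailFraction_mem_Icc hθ t (v i), hθα, hL, hR,
    fun i j h => tailFraction_antitone hθ t h, fun κ hκ0 hκ hκα => ?_⟩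
  have hsum : 0 ≤ ∑ i, (κ i - w i * tailFraction t θ (v i)) * (v i - t) := by
    refine Finset.sum_nonneg fun i _ => ?_
    unfold tailFraction
    rcases lt_trichotomy (v i) t with h | h | h
    · rw [if_pos h]
      nlinarith [hκ i]
    · simp [h]
    · rw [if_neg h.not_gt, if_neg h.ne']
      nlinarith [hκ0 i]
  simp only [sub_mul, mul_sub, Finset.sum_sub_distrib, ← Finset.sum_mul, hκα, hθα] at hsum
  linarith

/-- Minimum principle for a discounted substochastic matrix. -/
theorem nonneg_of_discounted_le {S : Type*} [Fintype S] {γ : ℝ} (hγ0 : 0 ≤ γ) (hγ1 : γ < 1)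
    {c : S → S → ℝ} (hc : ∀ s s', 0 ≤ c s s') (hc1 : ∀ s, ∑ s', c s s' ≤ 1) {f : S → ℝ}
    (hf : ∀ s, γ * ∑ s', c s s' * f s' ≤ f s) (s : S) : 0 ≤ f s := by
  have : Nonempty S := ⟨s⟩
  obtain ⟨s₀, hs₀⟩ := Finite.exists_min f
  refine le_trans ?_ (hs₀ s)
  by_contra! hneg
  have h1 : (∑ s', c s₀ s') * f s₀ ≤ ∑ s', c s₀ s' * f s' := by
    rw [Finset.sum_mul]
    exact Finset.sum_le_sum fun s' _ => mul_le_mul_of_nonneg_left (hs₀ s') (hc _ _)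
  have h2 : f s₀ ≤ (∑ s', c s₀ s') * f s₀ := by nlinarith [hc1 s₀]
  nlinarith [hf s₀, mul_le_mul_of_nonneg_left (h2.trans h1) hγ0]

theorem eq_zero_of_discounted_eq {S : Type*} [Fintype S] {γ : ℝ} (hγ0 : 0 ≤ γ) (hγ1 : γ < 1)
    {c : S → S → ℝ} (hc : ∀ s s', 0 ≤ c s s') (hc1 : ∀ s, ∑ s', c s s' ≤ 1) {f : S → ℝ}
    (hf : ∀ s, f s = γ * ∑ s', c s s' * f s') (s : S) : f s = 0 := by
  refine le_antisymm ?_ (nonneg_of_discounted_le hγ0 hγ1 hc hc1 (fun s => (hf s).ge) s)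
  refine neg_nonneg.1 (nonneg_of_discounted_le (f := fun s => -f s) hγ0 hγ1 hc hc1 (fun s => ?_) s)
  simp [← hf s]

/-- The conditional probability of the worst-case or best-case substate. -/
def substateMass (α : ℝ) (b : Bool) : ℝ := if b then 1 - α else α

/-- The function on the augmented state space with worst-case part `V1` and best-case part
`V2`. -/
def augFun (V1 V2 : X → ℝ) (s : X × Bool) : ℝ := if s.2 then V2 s.1 else V1 s.1

/-- The atom of the Bellman target at the augmented successor state `s`. -/
def augTarget (M : MDP X A) (V1 V2 : X → ℝ) (x : X) (a : A) (s : X × Bool) : ℝ :=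
  M.r x a s.1 + M.γ * augFun V1 V2 s

theorem diatomicMeasure_of_coherent (M : MDP X A) (α : ℝ)
    {π : X → A → ℝ} (hπ : IsPolicy π) {Q : X → A → ℝ × ℝ} {V1 V2 : X → ℝ}
    (hcoh : ∀ x a, 0 < π x a → Q x a = (V1 x, V2 x)) (x : X) (a : A) :
    diatomicMeasure M α π Q x a = ∑ s : X × Bool,
      ENNReal.ofReal (M.P x a s.1 * substateMass α s.2) •
        Measure.dirac (augTarget M V1 V2 x a s) := by
  rw [diatomicMeasure, Fintype.sum_prod_type]
  refine Finset.sum_congr rfl fun x' _ => ?_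
  have hterm (a' : A) : ENNReal.ofReal (M.P x a x' * π x' a') •
      (ENNReal.ofReal α • Measure.dirac (M.r x a x' + M.γ * (Q x' a').1)
        + ENNReal.ofReal (1 - α) • Measure.dirac (M.r x a x' + M.γ * (Q x' a').2)) =
      ENNReal.ofReal (M.P x a x' * π x' a') •
      (ENNReal.ofReal α • Measure.dirac (M.r x a x' + M.γ * V1 x')
        + ENNReal.ofReal (1 - α) • Measure.dirac (M.r x a x' + M.γ * V2 x')) := by
    rcases (hπ.1 x' a').eq_or_lt with h | h
    · simp [← h]
    · rw [hcoh x' a' h]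
  have hP := M.P_nonneg x a x'
  rw [Finset.sum_congr rfl fun a' _ => hterm a', ← Finset.sum_smul,
    ← ENNReal.ofReal_sum_of_nonneg fun a' _ => mul_nonneg hP (hπ.1 x' a'),
    ← Finset.mul_sum, hπ.2, mul_one, smul_add, smul_smul, smul_smul, ← ENNReal.ofReal_mul hP,
    ← ENNReal.ofReal_mul hP, Fintype.sum_bool, add_comm]
  rfl

section

variable {M : MDP X A} {α : ℝ} {π : X → A → ℝ} {K : (X × Bool) → A → (X × Bool) → ℝ}

/-- Every kernel in the uncertainty set leaves the `α`-mixture of the value function unchanged: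
it solves the Bellman equation of the original process. -/
theorem InUncertaintySet.mixture_eq (hK : InUncertaintySet M α K) {V : X × Bool → ℝ}
    (hV : IsAugValue M π K V) (x : X) :
    α * V (x, false) + (1 - α) * V (x, true) = ∑ a, π x a * ∑ x', M.P x a x' *
      (M.r x a x' + M.γ * (α * V (x', false) + (1 - α) * V (x', true))) := by
  rw [hV (x, false), hV (x, true), Finset.mul_sum, Finset.mul_sum, ← Finset.sum_add_distrib]
  refine Finset.sum_congr rfl fun a _ => ?_
  rw [mul_left_comm, mul_left_comm (1 - α), ← mul_add, Fintype.sum_prod_type,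
    Fintype.sum_prod_type, Finset.mul_sum, Finset.mul_sum, ← Finset.sum_add_distrib]
  congr 1
  refine Finset.sum_congr rfl fun x' _ => ?_
  obtain ⟨h1, h2, -⟩ := hK.2.2 x a x'
  simp only [Fintype.sum_bool]
  linear_combination (M.r x a x' + M.γ * V (x', false)) * h1 +
    (M.r x a x' + M.γ * V (x', true)) * h2

/-- The matrix that propagates deviations of the worst-case values. -/
def deviationMatrix (α : ℝ) (π : X → A → ℝ) (K : (X × Bool) → A → (X × Bool) → ℝ)
    (x x' : X) : ℝ :=
  ∑ a, π x a * (K (x, false) a (x', false) - α / (1 - α) * K (x, false) a (x', true))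

theorem InUncertaintySet.deviationMatrix_nonneg (hK : InUncertaintySet M α K) (hπ : IsPolicy π)
    (x x' : X) : 0 ≤ deviationMatrix α π K x x' :=
  Finset.sum_nonneg fun a _ => mul_nonneg (hπ.1 x a) (sub_nonneg.2 (hK.2.2 x a x').2.2)

theorem InUncertaintySet.sum_deviationMatrix_le_one (hK : InUncertaintySet M α K)
    (hα : α ∈ Set.Ioo (0 : ℝ) 1) (hπ : IsPolicy π) (x : X) :
    ∑ x', deviationMatrix α π K x x' ≤ 1 := by
  unfold deviationMatrix
  rw [Finset.sum_comm]
  refine le_of_le_of_eq ?_ (hπ.2 x)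
  refine Finset.sum_le_sum fun a _ => ?_
  rw [← Finset.mul_sum]
  refine mul_le_of_le_one_right (hπ.1 x a) ?_
  refine le_of_le_of_eq ?_ (hK.2.1 (x, false) a)
  rw [Fintype.sum_prod_type]
  refine Finset.sum_le_sum fun x' _ => ?_
  rw [Fintype.sum_bool]
  have h0 := hK.1 (x, false) a (x', true)
  have h1 : 0 ≤ α / (1 - α) := div_nonneg hα.1.le (sub_pos.2 hα.2).le
  nlinarith

/-- The value functions of two augmented processes with the same `α`-mixture differ, on worst-case
states, by the one-step deviation plus the propagated deviation. -/
theorem IsAugValue.sub_eq {V : X × Bool → ℝ} (hV : IsAugValue M π K V)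
    (hα : α ∈ Set.Ioo (0 : ℝ) 1) {V1 V2 : X → ℝ}
    (hmix : ∀ x, α * V (x, false) + (1 - α) * V (x, true) = α * V1 x + (1 - α) * V2 x) (x : X) :
    V (x, false) - V1 x =
      ((∑ a, π x a * ∑ s, K (x, false) a s * augTarget M V1 V2 x a s) - V1 x) +
      M.γ * ∑ x', deviationMatrix α π K x x' * (V (x', false) - V1 x') := by
  have hα1 : 1 - α ≠ 0 := (sub_pos.2 hα.2).ne'
  have hup (x' : X) : V (x', true) = V2 x' - α / (1 - α) * (V (x', false) - V1 x') := by
    field_simp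
    linear_combination hmix x'
  have hdev : ∑ x', deviationMatrix α π K x x' * (V (x', false) - V1 x') =
      ∑ a, π x a * ∑ x', (K (x, false) a (x', false) - α / (1 - α) * K (x, false) a (x', true)) *
        (V (x', false) - V1 x') := by
    simp only [deviationMatrix, Finset.sum_mul, Finset.mul_sum]
    rw [Finset.sum_comm]
    simp only [mul_assoc]
  rw [hdev, hV (x, false), Finset.mul_sum, add_comm, ← add_sub_assoc, ← Finset.sum_add_distrib]
  congr 1
  refine Finset.sum_congr rfl fun a _ => ?_
  rw [mul_left_comm, ← mul_add, Fintype.sum_prod_type, Fintype.sum_prod_type,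
    Finset.mul_sum _ _ M.γ, ← Finset.sum_add_distrib]
  congr 1
  refine Finset.sum_congr rfl fun x' _ => ?_
  simp only [Fintype.sum_bool, augTarget, augFun, if_true, Bool.false_eq_true, if_false, hup x']
  ring

end

theorem sum_mul_substateMass (M : MDP X A) (α : ℝ) (x : X) (a : A) :
    ∑ s : X × Bool, M.P x a s.1 * substateMass α s.2 = 1 := by
  rw [Fintype.sum_prod_type, ← M.P_sum_one x a]
  refine Finset.sum_congr rfl fun x' _ => ?_
  simp only [Fintype.sum_bool, substateMass, if_true, Bool.false_eq_true, if_false]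
  ring

theorem mul_substateMass_nonneg (M : MDP X A) {α : ℝ} (hα : α ∈ Set.Ioo (0 : ℝ) 1) (x : X)
    (a : A) (s : X × Bool) : 0 ≤ M.P x a s.1 * substateMass α s.2 := by
  refine mul_nonneg (M.P_nonneg _ _ _) ?_
  unfold substateMass
  split_ifs
  · exact (sub_pos.2 hα.2).le
  · exact hα.1.le

theorem InUncertaintySet.mul_le_mul_substateMass {M : MDP X A} {α : ℝ}
    {K : (X × Bool) → A → (X × Bool) → ℝ} (hK : InUncertaintySet M α K)
    (hα : α ∈ Set.Ioo (0 : ℝ) 1) (x : X) (a : A) (s : X × Bool) :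
    α * K (x, false) a s ≤ M.P x a s.1 * substateMass α s.2 := by
  obtain ⟨x', b⟩ := s
  obtain ⟨h1, h2, -⟩ := hK.2.2 x a x'
  have h := mul_nonneg (sub_pos.2 hα.2).le (hK.1 (x, true) a (x', b))
  cases b <;> simp only [substateMass, if_true, Bool.false_eq_true, if_false] <;> linarith

/-- The transition kernel that splits the successor distribution along a family of tails. -/
def tailKernel (M : MDP X A) (α : ℝ) (φ : X → A → X × Bool → ℝ) (s : X × Bool) (a : A)
    (s' : X × Bool) : ℝ :=
  if s.2 then M.P s.1 a s'.1 * substateMass α s'.2 * (1 - φ s.1 a s') / (1 - α)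
  else M.P s.1 a s'.1 * substateMass α s'.2 * φ s.1 a s' / α

theorem inUncertaintySet_tailKernel (M : MDP X A) {α : ℝ} (hα : α ∈ Set.Ioo (0 : ℝ) 1)
    {φ : X → A → X × Bool → ℝ} (hφ : ∀ x a s, φ x a s ∈ Set.Icc (0 : ℝ) 1)
    (hsum : ∀ x a, ∑ s : X × Bool, M.P x a s.1 * substateMass α s.2 * φ x a s = α)
    (hle : ∀ x a x', φ x a (x', true) ≤ φ x a (x', false)) :
    InUncertaintySet M α (tailKernel M α φ) := by
  have hα0 : 0 < α := hα.1
  have hα1 : 0 < 1 - α := sub_pos.2 hα.2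
  refine ⟨?_, ?_, fun x a x' => ⟨?_, ?_, ?_⟩⟩
  · rintro ⟨x, b⟩ a s'
    have hw := mul_substateMass_nonneg M hα x a s'
    cases b
    · exact div_nonneg (mul_nonneg hw (hφ x a s').1) hα0.le
    · exact div_nonneg (mul_nonneg hw (sub_nonneg.2 (hφ x a s').2)) hα1.le
  · rintro ⟨x, b⟩ a
    cases b
    · simp only [tailKernel, Bool.false_eq_true, if_false]
      rw [← Finset.sum_div, hsum, div_self hα0.ne']
    · simp only [tailKernel, if_true]
      rw [← Finset.sum_div, div_eq_one_iff_eq hα1.ne']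
      simp only [mul_sub, mul_one, Finset.sum_sub_distrib, hsum, sum_mul_substateMass]
  · simp only [tailKernel, substateMass, if_true, Bool.false_eq_true, if_false]
    field_simp
    ring
  · simp only [tailKernel, substateMass, if_true, Bool.false_eq_true, if_false]
    field_simp
    ring
  · simp only [tailKernel, substateMass, if_true, Bool.false_eq_true, if_false]
    have h := mul_le_mul_of_nonneg_left (hle x a x') (M.P_nonneg x a x')
    field_simp
    exact h

theorem stmt10 (M : MDP X A) (α : ℝ) (hα : α ∈ Set.Ioo (0:ℝ) 1)
    (π : X → A → ℝ) (hπ : IsPolicy π)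
    (Qpi : X → A → ℝ × ℝ) (hfix : diatomicT M α π Qpi = Qpi)
    (V1 V2 : X → ℝ)
    (hcoh : ∀ x a, 0 < π x a → Qpi x a = (V1 x, V2 x))
    (Vof : ((X × Bool) → A → (X × Bool) → ℝ) → (X × Bool) → ℝ)
    (hVof : ∀ K, InUncertaintySet M α K → IsAugValue M π K (Vof K)) :
    (∀ K, InUncertaintySet M α K →
      ∀ x, V1 x ≤ Vof K (x, false) ∧ Vof K (x, true) ≤ V2 x) ∧
    ∃ Kstar, InUncertaintySet M α Kstar ∧
      ∀ x, Vof Kstar (x, false) = V1 x ∧ Vof Kstar (x, true) = V2 x := by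
  have hα0 : 0 < α := hα.1
  have hα1 : 0 < 1 - α := sub_pos.2 hα.2
  have hfix1 (x : X) (a : A) : avarLeft α (∑ s : X × Bool,
      ENNReal.ofReal (M.P x a s.1 * substateMass α s.2) •
        Measure.dirac (augTarget M V1 V2 x a s)) = (Qpi x a).1 := by
    rw [← diatomicMeasure_of_coherent M α hπ hcoh]
    exact congrArg Prod.fst (congrFun (congrFun hfix x) a)
  have hfix2 (x : X) (a : A) : avarRight α (∑ s : X × Bool,
      ENNReal.ofReal (M.P x a s.1 * substateMass α s.2) •
        Measure.dirac (augTarget M V1 V2 x a s)) = (Qpi x a).2 := by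
    rw [← diatomicMeasure_of_coherent M α hπ hcoh]
    exact congrArg Prod.snd (congrFun (congrFun hfix x) a)
  have htail (x : X) (a : A) := exists_lowerTail (mul_substateMass_nonneg M hα x a)
    (sum_mul_substateMass M α x a) (augTarget M V1 V2 x a) hα
  simp only [hfix1, hfix2] at htail
  choose φ hφ hφsum hleft hright hanti hmin using htail
  have hQmean (x : X) (a : A) : α * (Qpi x a).1 + (1 - α) * (Qpi x a).2 =
      ∑ s : X × Bool, M.P x a s.1 * substateMass α s.2 * augTarget M V1 V2 x a s := by
    rw [hleft, hright, ← Finset.sum_add_distrib]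
    exact Finset.sum_congr rfl fun s _ => by ring
  have havg (x : X) (g : A → ℝ) (z : ℝ) (hg : ∀ a, 0 < π x a → g a = z) :
      ∑ a, π x a * g a = z := by
    rw [← one_mul z, ← hπ.2 x, Finset.sum_mul]
    refine Finset.sum_congr rfl fun a _ => ?_
    rcases (hπ.1 x a).eq_or_lt with h | h
    · simp [← h]
    · rw [hg a h]
  have hV1 (x : X) : ∑ a, π x a * (Qpi x a).1 = V1 x :=
    havg x _ _ fun a ha => by rw [hcoh x a ha]
  have hV2 (x : X) : ∑ a, π x a * (Qpi x a).2 = V2 x :=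
    havg x _ _ fun a ha => by rw [hcoh x a ha]
  have hQle (x : X) (a : A) : (Qpi x a).1 ≤ (Qpi x a).2 := by
    have hw := mul_substateMass_nonneg M hα x a
    have h := hmin x a (fun s => α * (M.P x a s.1 * substateMass α s.2))
      (fun s => mul_nonneg hα0.le (hw s)) (fun s => mul_le_of_le_one_left (hw s) hα.2.le)
      (by rw [← Finset.mul_sum, sum_mul_substateMass, mul_one])
    simp only [mul_assoc α] at h
    rw [← hleft, ← Finset.mul_sum, ← hQmean] at h
    have h' := le_of_mul_le_mul_left h hα0
    exact le_of_mul_le_mul_left (by linarith) hα1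
  have hVle (x : X) : V1 x ≤ V2 x := by
    rw [← hV1, ← hV2]
    exact Finset.sum_le_sum fun a _ => mul_le_mul_of_nonneg_left (hQle x a) (hπ.1 x a)
  have hVmix (x : X) : α * V1 x + (1 - α) * V2 x = ∑ a, π x a * ∑ x', M.P x a x' *
      (M.r x a x' + M.γ * (α * V1 x' + (1 - α) * V2 x')) := by
    rw [← hV1, ← hV2, Finset.mul_sum, Finset.mul_sum, ← Finset.sum_add_distrib]
    refine Finset.sum_congr rfl fun a _ => ?_
    rw [mul_left_comm, mul_left_comm (1 - α), ← mul_add, hQmean, Fintype.sum_prod_type]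
    congr 1
    refine Finset.sum_congr rfl fun x' _ => ?_
    simp only [Fintype.sum_bool, substateMass, augTarget, augFun, if_true, Bool.false_eq_true,
      if_false]
    ring
  have hmix {K : (X × Bool) → A → (X × Bool) → ℝ} (hK : InUncertaintySet M α K) (x : X) :
      α * Vof K (x, false) + (1 - α) * Vof K (x, true) = α * V1 x + (1 - α) * V2 x := by
    refine sub_eq_zero.1 (eq_zero_of_discounted_eq M.γ_nonneg M.γ_lt_one
      (c := fun x x' => ∑ a, π x a * M.P x a x')
      (f := fun x => α * Vof K (x, false) + (1 - α) * Vof K (x, true) -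
        (α * V1 x + (1 - α) * V2 x))
      (fun x x' => Finset.sum_nonneg fun a _ => mul_nonneg (hπ.1 x a) (M.P_nonneg x a x'))
      (fun x => ?_) (fun x => ?_) x)
    · rw [Finset.sum_comm]
      simp only [← Finset.mul_sum, M.P_sum_one, mul_one, hπ.2, le_refl]
    · rw [hK.mixture_eq (hVof K hK) x, hVmix x, ← Finset.sum_sub_distrib]
      simp only [Finset.sum_mul, Finset.mul_sum]
      rw [Finset.sum_comm]
      simp only [← Finset.sum_sub_distrib]
      exact Finset.sum_congr rfl fun a _ => Finset.sum_congr rfl fun x' _ => by ring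
  have hupper {K : (X × Bool) → A → (X × Bool) → ℝ} (hK : InUncertaintySet M α K) (x : X) :
      (1 - α) * (Vof K (x, true) - V2 x) = -(α * (Vof K (x, false) - V1 x)) := by
    linear_combination hmix hK x
  have hsub {K : (X × Bool) → A → (X × Bool) → ℝ} (hK : InUncertaintySet M α K) :=
    (hVof K hK).sub_eq hα (hmix hK)
  refine ⟨fun K hK x => ?_, tailKernel M α φ, ?_⟩
  · have hstep (x : X) :
        V1 x ≤ ∑ a, π x a * ∑ s, K (x, false) a s * augTarget M V1 V2 x a s := by
      rw [← hV1]
      refine Finset.sum_le_sum fun a _ => mul_le_mul_of_nonneg_left ?_ (hπ.1 x a)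
      have h := hmin x a (fun s => α * K (x, false) a s)
        (fun s => mul_nonneg hα0.le (hK.1 _ _ _)) (hK.mul_le_mul_substateMass hα x a)
        (by rw [← Finset.mul_sum, hK.2.1, mul_one])
      simp only [mul_assoc α] at h
      rw [← hleft, ← Finset.mul_sum] at h
      exact le_of_mul_le_mul_left h hα0
    have hlow : 0 ≤ Vof K (x, false) - V1 x :=
      nonneg_of_discounted_le M.γ_nonneg M.γ_lt_one (hK.deviationMatrix_nonneg hπ)
        (hK.sum_deviationMatrix_le_one hα hπ) (f := fun x => Vof K (x, false) - V1 x)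
        (fun x => by linarith [hsub hK x, hstep x]) x
    refine ⟨sub_nonneg.1 hlow, ?_⟩
    nlinarith [hupper hK x]
  · have hK : InUncertaintySet M α (tailKernel M α φ) := by
      refine inUncertaintySet_tailKernel M hα hφ hφsum fun x a x' => hanti x a _ _ ?_
      simp only [augTarget, augFun, if_true, Bool.false_eq_true, if_false]
      gcongr
      · exact M.γ_nonneg
      · exact hVle x'
    have hstep (x : X) : ∑ a, π x a * ∑ s, tailKernel M α φ (x, false) a s *
        augTarget M V1 V2 x a s = V1 x := by
      rw [← hV1]
      refine Finset.sum_congr rfl fun a _ => ?_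
      congr 1
      simp only [tailKernel, Bool.false_eq_true, if_false, div_mul_eq_mul_div]
      rw [← Finset.sum_div, ← hleft, mul_div_cancel_left₀ _ hα0.ne']
    refine ⟨hK, fun x => ?_⟩
    have hlow : Vof (tailKernel M α φ) (x, false) - V1 x = 0 :=
      eq_zero_of_discounted_eq M.γ_nonneg M.γ_lt_one (hK.deviationMatrix_nonneg hπ)
        (hK.sum_deviationMatrix_le_one hα hπ)
        (f := fun x => Vof (tailKernel M α φ) (x, false) - V1 x)
        (fun x => by linarith [hsub hK x, hstep x]) x
    have hup := hupper hK x
    rw [hlow, mul_zero, neg_zero, mul_eq_zero, or_iff_right hα1.ne'] at hup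
    exact ⟨sub_eq_zero.1 hlow, sub_eq_zero.1 hup⟩

end
end
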